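/- arXiv:2012.10947 — 7 statements merged into one kernel-verified Lean document; each statement's English description precedes it below -/
import Mathlib

section
/- Let X be a topological space, φ : X → X a homeomorphism whose induced ℤ-action is free, and Y ⊆ X any subset. Then the orbit-breaking relation R_Y is an equivalence relation on X: it is reflexive, symmetric, and transitive. -/
/-- The orbit equivalence relation `R_φ = {(x, φⁿ x) : x ∈ X, n ∈ ℤ}`. -/
def orbitRel {X : Type*} (φ : Equiv.Perm X) : Set (X × X) :=
  {p | ∃ n : ℤ, (φ ^ n) p.1 = p.2}

/-- The pairs removed when breaking orbits over `Y`: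
`{(φᵏ y, φˡ y) : y ∈ Y, (l < 1 ≤ k or k < 1 ≤ l)}`. -/
def brokenPairs {X : Type*} (φ : Equiv.Perm X) (Y : Set X) : Set (X × X) :=
  {p | ∃ y ∈ Y, ∃ k l : ℤ, p.1 = (φ ^ k) y ∧ p.2 = (φ ^ l) y ∧
    ((l < 1 ∧ 1 ≤ k) ∨ (k < 1 ∧ 1 ≤ l))}

/-- The orbit-breaking relation `R_Y = R_φ \ brokenPairs`. -/
def orbitBreakingRel {X : Type*} (φ : Equiv.Perm X) (Y : Set X) : Set (X × X) :=
  orbitRel φ \ brokenPairs φ Y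

/-- Let `X` be a topological space, `φ : X → X` a homeomorphism whose induced
`ℤ`-action is free, and `Y ⊆ X` any subset.  Then the orbit-breaking relation `R_Y` is an
equivalence relation on `X`: reflexive, symmetric and transitive. -/
theorem orbitBreakingRel_equivalence {X : Type*} [TopologicalSpace X]
    (φ : Equiv.Perm X) (hφ : Continuous φ) (hφ' : Continuous φ.symm)
    (hfree : ∀ (x : X) (n : ℤ), (φ ^ n) x = x → n = 0) (Y : Set X) :
    Equivalence (fun x x' : X => (x, x') ∈ orbitBreakingRel φ Y) := by
  refine ⟨fun x => ⟨⟨0, by simp⟩, ?_⟩, ?_, ?_⟩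
  · rintro ⟨y, -, k, l, hk, hl, h⟩
    have hkl : k - l = 0 := by
      apply hfree ((φ ^ l) y)
      rw [← Equiv.Perm.mul_apply, ← zpow_add, sub_add_cancel]
      exact hk.symm.trans hl
    omega
  · rintro x x' ⟨⟨n, hn⟩, hb⟩
    refine ⟨⟨-n, ?_⟩, ?_⟩
    · rw [zpow_neg, Equiv.Perm.inv_eq_iff_eq]
      exact hn.symm
    · rintro ⟨y, hy, k, l, hk, hl, h⟩
      exact hb ⟨y, hy, l, k, hl, hk, by omega⟩
  · rintro x x' x'' ⟨⟨n, hn⟩, hb⟩ ⟨⟨m, hm⟩, hb'⟩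
    dsimp only at hn hm
    refine ⟨⟨m + n, ?_⟩, ?_⟩
    · simp only [zpow_add, Equiv.Perm.mul_apply, hn, hm]
    · rintro ⟨y, hy, k, l, hk, hl, h⟩
      dsimp only at hk hl
      have hx' : x' = (φ ^ (n + k)) y := by
        rw [zpow_add, Equiv.Perm.mul_apply, ← hk, hn]
      by_cases hc : (n + k < 1 ∧ 1 ≤ k) ∨ (k < 1 ∧ 1 ≤ n + k)
      · exact hb ⟨y, hy, k, n + k, hk, hx', hc⟩
      · exact hb' ⟨y, hy, n + k, l, hx', hl, by omega⟩
end

section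
/- Let X be a topological space, φ : X → X a homeomorphism whose induced ℤ-action is free, and Y ⊆ X a subset meeting every φ-orbit at most once. Then for every y ∈ Y, the R_Y-equivalence class of y is the backward orbit {φⁿ(y) : n ≤ 0}, and the R_Y-equivalence class of φ(y) is the forward orbit {φⁿ(y) : n ≥ 1}. -/
/-- If `Y` meets every `φ`-orbit at most once, a point is `φᵏ z` with `z ∈ Y` for at most one
pair `(k, z)`. -/
theorem zpow_apply_injOn_of_disjoint {X : Type*} {φ : Equiv.Perm X} {Y : Set X}
    (hY : ∀ n : ℤ, n ≠ 0 → (fun x => (φ ^ n) x) '' Y ∩ Y = ∅) {y z : X} (hy : y ∈ Y)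
    (hz : z ∈ Y) {a k : ℤ} (h : (φ ^ a) y = (φ ^ k) z) : a = k ∧ y = z := by
  have hyz : (φ ^ (a - k)) y = z := by
    rw [sub_eq_neg_add, zpow_add, Equiv.Perm.mul_apply, h, ← Equiv.Perm.mul_apply, ← zpow_add]
    simp
  have hak : a = k := by
    by_contra hne
    have hmem : z ∈ (fun x => (φ ^ (a - k)) x) '' Y ∩ Y := ⟨⟨y, hy, hyz⟩, hz⟩
    rw [hY _ (sub_ne_zero.mpr hne)] at hmem
    exact hmem
  subst hak
  exact ⟨rfl, (φ ^ a).injective h⟩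

/-- Two points of the orbit of `y ∈ Y` are related by `R_Y` iff they lie on the same side of the
cut between `y` and `φ y`. -/
theorem zpow_apply_mem_orbitBreakingRel_iff {X : Type*} {φ : Equiv.Perm X} {Y : Set X}
    (hY : ∀ n : ℤ, n ≠ 0 → (fun x => (φ ^ n) x) '' Y ∩ Y = ∅) {y : X} (hy : y ∈ Y) (a b : ℤ) :
    ((φ ^ a) y, (φ ^ b) y) ∈ orbitBreakingRel φ Y ↔ (1 ≤ a ↔ 1 ≤ b) := by
  constructor
  · rintro ⟨-, hnot⟩
    by_contra hab
    exact hnot ⟨y, hy, a, b, rfl, rfl, by omega⟩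
  · intro hab
    refine ⟨⟨b - a, ?_⟩, ?_⟩
    · change (φ ^ (b - a)) ((φ ^ a) y) = (φ ^ b) y
      rw [← Equiv.Perm.mul_apply, ← zpow_add, sub_add_cancel]
    · rintro ⟨z, hz, k, l, hk, hl, hkl⟩
      have hak := (zpow_apply_injOn_of_disjoint hY hy hz hk).1
      have hbl := (zpow_apply_injOn_of_disjoint hY hy hz hl).1
      omega

/-- The `R_Y`-class of `φᵃ y`, for `y ∈ Y`, is the part of the orbit of `y` on the same side of
the cut. -/
theorem setOf_zpow_apply_mem_orbitBreakingRel {X : Type*} {φ : Equiv.Perm X} {Y : Set X}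
    (hY : ∀ n : ℤ, n ≠ 0 → (fun x => (φ ^ n) x) '' Y ∩ Y = ∅) {y : X} (hy : y ∈ Y) (a : ℤ) :
    {x : X | ((φ ^ a) y, x) ∈ orbitBreakingRel φ Y} =
      {x : X | ∃ n : ℤ, (1 ≤ a ↔ 1 ≤ n) ∧ (φ ^ n) y = x} := by
  ext x
  constructor
  · intro hx
    obtain ⟨m, hm⟩ := hx.1
    have hmx : (φ ^ (m + a)) y = x := by
      rw [zpow_add, Equiv.Perm.mul_apply]
      exact hm
    subst hmx
    exact ⟨m + a, (zpow_apply_mem_orbitBreakingRel_iff hY hy a _).1 hx, rfl⟩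
  · rintro ⟨n, hn, rfl⟩
    exact (zpow_apply_mem_orbitBreakingRel_iff hY hy a n).2 hn

/-- Let `X` be a topological space, `φ` a homeomorphism with free `ℤ`-action, and
`Y ⊆ X` a subset meeting every `φ`-orbit at most once (`φⁿ(Y) ∩ Y = ∅` for `n ≠ 0`).  Then for
every `y ∈ Y`, the `R_Y`-class of `y` is the backward orbit `{φⁿ y : n ≤ 0}` and the
`R_Y`-class of `φ y` is the forward orbit `{φⁿ y : n ≥ 1}`. -/
theorem orbitBreakingRel_classes {X : Type*} [TopologicalSpace X]
    (φ : Equiv.Perm X) (hφ : Continuous φ) (hφ' : Continuous φ.symm)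
    (hfree : ∀ (x : X) (n : ℤ), (φ ^ n) x = x → n = 0) (Y : Set X)
    (hY : ∀ n : ℤ, n ≠ 0 → (fun x => (φ ^ n) x) '' Y ∩ Y = ∅) :
    ∀ y ∈ Y,
      {x' : X | (y, x') ∈ orbitBreakingRel φ Y} = {x' : X | ∃ n : ℤ, n ≤ 0 ∧ (φ ^ n) y = x'} ∧
      {x' : X | (φ y, x') ∈ orbitBreakingRel φ Y} =
        {x' : X | ∃ n : ℤ, 1 ≤ n ∧ (φ ^ n) y = x'} := by
  intro y hy
  have hback : ∀ n : ℤ, ((1 : ℤ) ≤ 0 ↔ 1 ≤ n) ↔ n ≤ 0 := fun n => by omega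
  have hforw : ∀ n : ℤ, ((1 : ℤ) ≤ 1 ↔ 1 ≤ n) ↔ 1 ≤ n := fun n => by omega
  have h0 := setOf_zpow_apply_mem_orbitBreakingRel hY hy 0
  have h1 := setOf_zpow_apply_mem_orbitBreakingRel hY hy 1
  simp only [hback, zpow_zero, Equiv.Perm.one_apply] at h0
  simp only [hforw, zpow_one] at h1
  exact ⟨h0, h1⟩
end

section
/- Let X be an infinite compact metric space, φ : X → X a minimal homeomorphism, and Y a closed non-empty subset of X meeting every φ-orbit at most once. Then the orbit-breaking relation R_Y is minimal: for every x ∈ X, the R_Y-equivalence class {x' ∈ X : (x, x') ∈ R_Y} is dense in X. -/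
theorem continuous_perm_zpow {X : Type*} [TopologicalSpace X] {φ : Equiv.Perm X}
    (hφ : Continuous φ) (hφ' : Continuous φ.symm) (n : ℤ) : Continuous ⇑(φ ^ n) := by
  have key (ψ : Equiv.Perm X) (hψ : Continuous ψ) (m : ℕ) : Continuous ⇑(ψ ^ m) := by
    rw [← Equiv.Perm.iterate_eq_pow]
    exact hψ.iterate m
  obtain ⟨m, rfl | rfl⟩ := n.eq_nat_or_neg
  · rw [zpow_natCast]
    exact key φ hφ m
  · rw [zpow_neg, zpow_natCast, ← inv_pow]
    exact key φ⁻¹ hφ' m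

/-- On a compact space, return times of a minimal homeomorphism to a nonempty open set are
uniformly bounded. -/
theorem exists_abs_le_zpow_mem_of_dense_orbits {X : Type*} [TopologicalSpace X] [CompactSpace X]
    {φ : Equiv.Perm X} (hφ : Continuous φ) (hφ' : Continuous φ.symm)
    (hmin : ∀ x : X, Dense {y : X | ∃ n : ℤ, (φ ^ n) x = y})
    {U : Set X} (hU : IsOpen U) (hUne : U.Nonempty) :
    ∃ N : ℤ, ∀ x : X, ∃ n : ℤ, |n| ≤ N ∧ (φ ^ n) x ∈ U := by
  obtain ⟨t, ht⟩ := isCompact_univ.elim_finite_subcover (fun n : ℤ => ⇑(φ ^ n) ⁻¹' U)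
    (fun n => hU.preimage (continuous_perm_zpow hφ hφ' n)) (fun x _ => by
      obtain ⟨_, hyU, n, rfl⟩ := (hmin x).inter_open_nonempty U hU hUne
      exact Set.mem_iUnion.2 ⟨n, hyU⟩)
  refine ⟨∑ n ∈ t, |n|, fun x => ?_⟩
  obtain ⟨n, hn, hx⟩ := Set.mem_iUnion₂.1 (ht (Set.mem_univ x))
  exact ⟨n, Finset.single_le_sum (f := fun n : ℤ => |n|) (fun i _ => abs_nonneg i) hn, hx⟩

theorem zpow_apply_zpow_apply {X : Type*} (φ : Equiv.Perm X) (m n : ℤ) (x : X) :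
    (φ ^ m) ((φ ^ n) x) = (φ ^ (m + n)) x := by
  rw [zpow_add, Equiv.Perm.mul_apply]

theorem eq_of_zpow_apply_eq_zpow_apply {X : Type*} {φ : Equiv.Perm X} {Y : Set X}
    (hY : ∀ n : ℤ, n ≠ 0 → (fun x => (φ ^ n) x) '' Y ∩ Y = ∅)
    {y z : X} (hy : y ∈ Y) (hz : z ∈ Y) {k l : ℤ} (h : (φ ^ k) y = (φ ^ l) z) : k = l := by
  by_contra hkl
  have hz' : (φ ^ (k - l)) y = z := by
    rw [sub_eq_neg_add, ← zpow_apply_zpow_apply, h, zpow_apply_zpow_apply, neg_add_cancel,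
      zpow_zero, Equiv.Perm.one_apply]
  exact (hY (k - l) (sub_ne_zero.2 hkl)).subset ⟨⟨y, hy, hz'⟩, hz⟩

/-- Let `X` be an infinite compact metric space, `φ : X → X` a minimal
homeomorphism, and `Y` a closed non-empty subset of `X` meeting every `φ`-orbit at most once.
Then the orbit-breaking relation `R_Y` is minimal: every `R_Y`-equivalence class is dense. -/
theorem orbitBreakingRel_minimal {X : Type*} [MetricSpace X] [CompactSpace X] [Infinite X]
    (φ : Equiv.Perm X) (hφ : Continuous φ) (hφ' : Continuous φ.symm)
    (hmin : ∀ x : X, Dense {y : X | ∃ n : ℤ, (φ ^ n) x = y})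
    (Y : Set X) (hYc : IsClosed Y) (hYne : Y.Nonempty)
    (hY : ∀ n : ℤ, n ≠ 0 → (fun x => (φ ^ n) x) '' Y ∩ Y = ∅) :
    ∀ x : X, Dense {x' : X | (x, x') ∈ orbitBreakingRel φ Y} := by
  intro x
  rw [dense_iff_inter_open]
  intro U hU hUne
  obtain ⟨N, hN⟩ := exists_abs_le_zpow_mem_of_dense_orbits hφ hφ' hmin hU hUne
  by_cases hx : ∃ y ∈ Y, ∃ k : ℤ, 1 ≤ k ∧ x = (φ ^ k) y
  · obtain ⟨y, hy, k, hk, hxy⟩ := hx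
    obtain ⟨n, hn, hnU⟩ := hN ((φ ^ N) x)
    rw [zpow_apply_zpow_apply] at hnU
    refine ⟨_, hnU, ⟨n + N, rfl⟩, ?_⟩
    rintro ⟨z, hz, k', l, h₁, h₂, h⟩
    dsimp only at h₁ h₂
    have hk' := eq_of_zpow_apply_eq_zpow_apply hY hy hz (hxy.symm.trans h₁)
    rw [h₁, zpow_apply_zpow_apply] at h₂
    have hl := eq_of_zpow_apply_eq_zpow_apply hY hz hz h₂
    have := neg_le_of_abs_le hn
    omega
  · obtain ⟨n, hn, hnU⟩ := hN ((φ ^ (-N)) x)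
    rw [zpow_apply_zpow_apply] at hnU
    refine ⟨_, hnU, ⟨n + -N, rfl⟩, ?_⟩
    rintro ⟨z, hz, k', l, h₁, h₂, h⟩
    dsimp only at h₁ h₂
    have hk' : ¬ 1 ≤ k' := fun hk => hx ⟨z, hz, k', hk, h₁⟩
    rw [h₁, zpow_apply_zpow_apply] at h₂
    have hl := eq_of_zpow_apply_eq_zpow_apply hY hz hz h₂
    have := le_of_abs_le hn
    omega
end

section
/- Let X be a topological space, φ : X → X a homeomorphism whose induced ℤ-action is free, and Y ⊆ X a closed subset. Then for every n ∈ ℤ, the set {x ∈ X : (x, φⁿ(x)) ∈ R_Y} is open in X. -/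
theorem Equiv.Perm.continuous_zpow {X : Type*} [TopologicalSpace X] {φ : Equiv.Perm X}
    (hφ : Continuous φ) (hφ' : Continuous φ.symm) (n : ℤ) : Continuous (φ ^ n) := by
  have hpow {ψ : Equiv.Perm X} (hψ : Continuous ψ) (m : ℕ) : Continuous (ψ ^ m) := by
    rw [Equiv.Perm.coe_pow]
    exact hψ.iterate m
  cases n with
  | ofNat m => simpa using hpow hφ m
  | negSucc m =>
    rw [zpow_negSucc, ← inv_pow]
    exact hpow (ψ := φ⁻¹) hφ' (m + 1)

/-- For a free action, `(x, φⁿ x)` is broken exactly when `x = φᵏ y` for some `y ∈ Y` such that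
the orbit segment from `φᵏ y` to `φᵏ⁺ⁿ y` crosses the cut between `y` and `φ y`. -/
theorem mk_zpow_mem_brokenPairs_iff {X : Type*} {φ : Equiv.Perm X}
    (hfree : ∀ (x : X) (n : ℤ), (φ ^ n) x = x → n = 0) {Y : Set X} {x : X} {n : ℤ} :
    (x, (φ ^ n) x) ∈ brokenPairs φ Y ↔
      ∃ k : ℤ, ((k + n < 1 ∧ 1 ≤ k) ∨ (k < 1 ∧ 1 ≤ k + n)) ∧ (φ ^ (-k)) x ∈ Y := by
  constructor
  · rintro ⟨y, hy, k, l, rfl, hl, hkl⟩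
    have hfix : (φ ^ (-l + (n + k))) y = y := by
      simp only [zpow_add, Equiv.Perm.mul_apply] at hl ⊢
      rw [hl, ← Equiv.Perm.mul_apply, ← zpow_add, neg_add_cancel, zpow_zero,
        Equiv.Perm.one_apply]
    have := hfree y _ hfix
    refine ⟨k, by omega, ?_⟩
    rwa [← Equiv.Perm.mul_apply, ← zpow_add, neg_add_cancel, zpow_zero, Equiv.Perm.one_apply]
  · rintro ⟨k, hk, hy⟩
    refine ⟨_, hy, k, k + n, ?_, ?_, hk⟩ <;>
      simp only [← Equiv.Perm.mul_apply, ← zpow_add]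
    · rw [add_neg_cancel, zpow_zero, Equiv.Perm.one_apply]
    · rw [add_neg_cancel_comm]

/-- Let `X` be a topological space, `φ : X → X` a homeomorphism whose induced
`ℤ`-action is free, and `Y ⊆ X` a closed subset.  Then for every `n ∈ ℤ`, the set
`{x ∈ X : (x, φⁿ x) ∈ R_Y}` is open in `X`. -/
theorem orbitBreakingRel_sections_open {X : Type*} [TopologicalSpace X]
    (φ : Equiv.Perm X) (hφ : Continuous φ) (hφ' : Continuous φ.symm)
    (hfree : ∀ (x : X) (n : ℤ), (φ ^ n) x = x → n = 0)
    (Y : Set X) (hYc : IsClosed Y) :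
    ∀ n : ℤ, IsOpen {x : X | (x, (φ ^ n) x) ∈ orbitBreakingRel φ Y} := by
  intro n
  have hfin : {k : ℤ | (k + n < 1 ∧ 1 ≤ k) ∨ (k < 1 ∧ 1 ≤ k + n)}.Finite :=
    (Set.finite_Icc (-|n|) |n|).subset fun k hk => by
      have := neg_abs_le n
      have := le_abs_self n
      simp only [Set.mem_ofPred_eq] at hk
      constructor <;> omega
  have hclosed := hfin.isClosed_biUnion fun k _ =>
    hYc.preimage (Equiv.Perm.continuous_zpow hφ hφ' (-k))
  convert hclosed.isOpen_compl using 1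
  ext x
  have hx : (x, (φ ^ n) x) ∈ orbitRel φ := ⟨n, rfl⟩
  simp only [orbitBreakingRel, Set.mem_ofPred_eq, Set.mem_sdiff, hx, true_and,
    mk_zpow_mem_brokenPairs_iff hfree, Set.mem_compl_iff, Set.mem_iUnion, Set.mem_preimage,
    exists_prop]
end

section
/- Let X be a topological space, φ : X → X a homeomorphism whose induced ℤ-action is free, and Y ⊆ X any subset. Then for every integer n ≥ 1, the set of points x ∈ X such that the pair (x, φⁿ(x)) is NOT in the orbit-breaking relation R_Y equals the finite union ⋃_{j=0}^{n−1} φ^{−j}(Y). -/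
/-- For a free action, two powers of `φ` agreeing at a point have equal exponents. -/
theorem Equiv.Perm.zpow_apply_injective_of_free {X : Type*} {φ : Equiv.Perm X}
    (hfree : ∀ (x : X) (n : ℤ), (φ ^ n) x = x → n = 0) (x : X) :
    Function.Injective fun n : ℤ => (φ ^ n) x := by
  intro m n h
  have h' : (φ ^ (-n + m)) x = x := by
    rw [zpow_add, Equiv.Perm.mul_apply, show (φ ^ m) x = (φ ^ n) x from h,
      ← Equiv.Perm.mul_apply, ← zpow_add, neg_add_cancel, zpow_zero, Equiv.Perm.one_apply]
  have := hfree x _ h'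
  omega

/-- Let `X` be a topological space, `φ : X → X` a homeomorphism whose induced
`ℤ`-action is free, and `Y ⊆ X` any subset.  Then for every integer `n ≥ 1`, the set of `x ∈ X`
with `(x, φⁿ x) ∉ R_Y` equals the finite union `⋃_{j=0}^{n-1} φ^{-j}(Y)`. -/
theorem orbitBreakingRel_complement_eq_union {X : Type*} [TopologicalSpace X]
    (φ : Equiv.Perm X) (hφ : Continuous φ) (hφ' : Continuous φ.symm)
    (hfree : ∀ (x : X) (n : ℤ), (φ ^ n) x = x → n = 0) (Y : Set X) :
    ∀ n : ℕ, 1 ≤ n →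
      {x : X | (x, (φ ^ (n : ℤ)) x) ∉ orbitBreakingRel φ Y} =
        ⋃ j ∈ Finset.range n, (fun y => (φ ^ (-(j : ℤ))) y) '' Y := by
  intro n hn
  ext x
  have hx : (x, (φ ^ (n : ℤ)) x) ∈ orbitRel φ := ⟨n, rfl⟩
  simp only [orbitBreakingRel, Set.mem_ofPred_eq, Set.mem_sdiff, hx, true_and, not_not,
    Set.mem_iUnion, Finset.mem_range, exists_prop, Set.mem_image]
  constructor
  · rintro ⟨y, hy, k, l, rfl, hl, hkl⟩
    have hnk : (n : ℤ) + k = l := by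
      apply Equiv.Perm.zpow_apply_injective_of_free hfree y
      simpa only [zpow_add, Equiv.Perm.mul_apply] using hl
    refine ⟨(-k).toNat, by omega, y, hy, ?_⟩
    rw [show -(((-k).toNat : ℕ) : ℤ) = k by omega]
  · rintro ⟨j, hj, y, hy, rfl⟩
    refine ⟨y, hy, -j, n + -j, rfl, ?_, by omega⟩
    simp only [zpow_add, Equiv.Perm.mul_apply]
end

section
/- For every integer n ≥ 1, the cokernel of the ℤ-linear map ℤ^{n−1} → ℤ^{n−1} given by multiplication by the matrix 1 − B is isomorphic, as an abelian group, to ℤ/nℤ. -/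
/-- For `n ≥ 1`, the `(n-1) × (n-1)` integer matrix with `1`'s on the subdiagonal,
`-1`'s down the last column, and `0`'s elsewhere (for `n = 2`, `B = (-1)`; for `n = 1`,
`B` is the empty `0 × 0` matrix).  Indices here run over `Fin (n-1)`, i.e. `0, …, n-2`,
so the subdiagonal is `i = j + 1` and the last column is `j = n - 2`. -/
def Bmat (n : ℕ) : Matrix (Fin (n - 1)) (Fin (n - 1)) ℤ :=
  fun i j => (if (i : ℕ) = (j : ℕ) + 1 then 1 else 0) + (if (j : ℕ) = n - 2 then -1 else 0)

theorem one_sub_Bmat_mulVec_zero (k : ℕ) (x : Fin (k + 1) → ℤ) :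
    (1 - Bmat (k + 2)).mulVec x (0 : Fin (k + 1)) = x 0 + x (Fin.last k) := by
  have hlast (j : Fin (k + 1)) : (j : ℕ) = k ↔ j = Fin.last k := by simp [Fin.ext_iff]
  rw [Matrix.sub_mulVec, Pi.sub_apply, Matrix.one_mulVec]
  simp [Matrix.mulVec, dotProduct, Bmat, hlast]

theorem one_sub_Bmat_mulVec_succ (k : ℕ) (x : Fin (k + 1) → ℤ) (i : Fin k) :
    (1 - Bmat (k + 2)).mulVec x (i.succ : Fin (k + 1)) =
      x i.succ - x i.castSucc + x (Fin.last k) := by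
  have hlast (j : Fin (k + 1)) : (j : ℕ) = k ↔ j = Fin.last k := by simp [Fin.ext_iff]
  have hsub (j : Fin (k + 1)) : (i : ℕ) = j ↔ i.castSucc = j := by simp [Fin.ext_iff]
  rw [Matrix.sub_mulVec, Pi.sub_apply, Matrix.one_mulVec]
  simp [Matrix.mulVec, dotProduct, Bmat, hlast, hsub, add_mul, Finset.sum_add_distrib]
  ring

theorem sum_one_sub_Bmat_mulVec (k : ℕ) (x : Fin (k + 1) → ℤ) :
    ∑ i : Fin (k + 1), (1 - Bmat (k + 2)).mulVec x i = (k + 2) * x (Fin.last k) := by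
  rw [Fin.sum_univ_succ, one_sub_Bmat_mulVec_zero]
  simp only [one_sub_Bmat_mulVec_succ, Finset.sum_add_distrib, Finset.sum_sub_distrib,
    Finset.sum_const, Finset.card_univ, Fintype.card_fin, nsmul_eq_mul]
  linear_combination Fin.sum_univ_castSucc x - Fin.sum_univ_succ x

theorem exists_one_sub_Bmat_mulVec_eq (k : ℕ) (v : Fin (k + 1) → ℤ) (c : ℤ)
    (hv : ∑ i, v i = (k + 2) * c) :
    ∃ x : Fin (k + 1) → ℤ, (1 - Bmat (k + 2)).mulVec x = v := by
  let x : Fin (k + 1) → ℤ := fun i => ∑ j ∈ Finset.Iic i, v j - ((i : ℕ) + 1) * c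
  have hlast : x (Fin.last k) = c := by
    have huniv : Finset.Iic (Fin.last k) = Finset.univ := by
      ext j
      simp [Fin.le_last]
    simp only [x, huniv, hv, Fin.val_last]
    ring
  refine ⟨x, funext fun i => ?_⟩
  refine Fin.cases ?_ (fun i => ?_) (i : Fin (k + 1))
  · have hIic : Finset.Iic (0 : Fin (k + 1)) = {0} := by
      ext j
      simp
    rw [one_sub_Bmat_mulVec_zero, hlast]
    simp [x, hIic]
  · have hIic : Finset.Iic i.succ = insert i.succ (Finset.Iic i.castSucc) := by
      ext j
      simp only [Finset.mem_Iic, Finset.mem_insert, Fin.le_def, Fin.ext_iff, Fin.val_succ,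
        Fin.val_castSucc]
      omega
    have hnotMem : i.succ ∉ Finset.Iic i.castSucc := by simp [Fin.le_def]
    rw [one_sub_Bmat_mulVec_succ, hlast]
    simp only [x, hIic, Finset.sum_insert hnotMem, Fin.val_succ, Fin.val_castSucc]
    push_cast
    ring

/-- The sum of the coordinates of an integer vector, reduced modulo `n`. -/
def coordSumMod (m n : ℕ) : (Fin m → ℤ) →+ ZMod n where
  toFun v := ((∑ i, v i : ℤ) : ZMod n)
  map_zero' := by simp
  map_add' v w := by simp [Finset.sum_add_distrib]

theorem coordSumMod_surjective (k n : ℕ) : Function.Surjective (coordSumMod (k + 1) n) := by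
  intro a
  obtain ⟨z, rfl⟩ := ZMod.intCast_surjective a
  exact ⟨Pi.single 0 z, by
    simp only [coordSumMod, AddMonoidHom.coe_mk, ZeroHom.coe_mk, Finset.sum_pi_single',
      Finset.mem_univ, if_true]⟩

theorem range_one_sub_Bmat_eq_ker (k : ℕ) :
    (LinearMap.range (Matrix.toLin' (1 - Bmat (k + 2)))).toAddSubgroup =
      (coordSumMod (k + 1) (k + 2)).ker := by
  ext v
  rw [AddMonoidHom.mem_ker]
  change (∃ x, (1 - Bmat (k + 2)).mulVec x = v) ↔ ((∑ i, v i : ℤ) : ZMod (k + 2)) = 0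
  rw [ZMod.intCast_zmod_eq_zero_iff_dvd]
  push_cast
  constructor
  · rintro ⟨x, rfl⟩
    exact ⟨_, sum_one_sub_Bmat_mulVec k x⟩
  · rintro ⟨c, hc⟩
    exact exists_one_sub_Bmat_mulVec_eq k v c hc

/-- For every integer `n ≥ 1`, the cokernel of the `ℤ`-linear map
`ℤ^{n-1} → ℤ^{n-1}` given by multiplication by `1 - B` is isomorphic, as an abelian group,
to `ℤ/nℤ`. -/
theorem coker_one_sub_Bmat (n : ℕ) (hn : 1 ≤ n) :
    Nonempty (((Fin (n - 1) → ℤ) ⧸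
      LinearMap.range (Matrix.toLin' (1 - Bmat n))) ≃+ ZMod n) := by
  obtain _ | _ | k := n
  · omega
  · have : Subsingleton (Fin (0 + 1 - 1) → ℤ) := inferInstanceAs (Subsingleton (Fin 0 → ℤ))
    have : Subsingleton ((Fin (0 + 1 - 1) → ℤ) ⧸
        LinearMap.range (Matrix.toLin' (1 - Bmat (0 + 1)))) :=
      (Submodule.Quotient.mk_surjective _).subsingleton
    have : Subsingleton (ZMod (0 + 1)) := inferInstanceAs (Subsingleton (ZMod 1))
    exact ⟨⟨⟨0, 0, fun _ => Subsingleton.elim _ _, fun _ => Subsingleton.elim _ _⟩,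
      fun _ _ => Subsingleton.elim _ _⟩⟩
  · exact ⟨(QuotientAddGroup.quotientAddEquivOfEq (range_one_sub_Bmat_eq_ker k)).trans
      (QuotientAddGroup.quotientKerEquivOfSurjective _ (coordSumMod_surjective k (k + 2)))⟩
end

section
/- For every integer n ≥ 2, there exist matrices P and Q in GL_{n−1}(ℤ) (integer matrices invertible over ℤ) such that P(1 − B)Q is the diagonal matrix diag(1, 1, …, 1, n); that is, the Smith normal form of 1 − B is diag(1, …, 1, n). -/
/-- Multiplying by the matrix with `1` on the diagonal and `-1` on the subdiagonal subtracts from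
each row the row above it. -/
theorem sub_subdiagonal_mul_apply {m : ℕ} (R : Matrix (Fin m) (Fin m) ℤ) (i j : Fin m) :
    ((1 - Matrix.of fun i k : Fin m => if (i : ℕ) = k + 1 then (1 : ℤ) else 0) * R) i j =
      R i j - if h : (i : ℕ) = 0 then 0 else R ⟨i - 1, by omega⟩ j := by
  rw [Matrix.sub_mul, Matrix.one_mul, Matrix.sub_apply, Matrix.mul_apply]
  congr 1
  split_ifs with h
  · exact Finset.sum_eq_zero fun k _ => by simp [h]
  · rw [Finset.sum_eq_single ⟨i - 1, by omega⟩]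
    · have : (i : ℕ) = i - 1 + 1 := by omega
      rw [Matrix.of_apply, if_pos this, one_mul]
    · intro k _ hk
      have : (i : ℕ) ≠ k + 1 := fun e => hk (Fin.ext (by simp [e]))
      simp [this]
    · simp

theorem det_sub_subdiagonal (m : ℕ) :
    (1 - Matrix.of fun i k : Fin m => if (i : ℕ) = k + 1 then (1 : ℤ) else 0).det = 1 := by
  rw [Matrix.det_of_isLowerTriangular]
  · simp
  · intro i j hij
    have hij : i < j := hij
    have h : (i : ℕ) ≠ j + 1 := by have : (i : ℕ) < j := hij; omega
    simp [hij.ne, h]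

theorem det_one_add_lastColumn (m : ℕ) :
    (1 + Matrix.of fun i j : Fin m =>
      if i < j ∧ (j : ℕ) + 1 = m then (i : ℤ) + 1 else 0).det = 1 := by
  rw [Matrix.det_of_isUpperTriangular]
  · simp
  · intro i j hij
    have hij : j < i := hij
    simp [hij.ne', hij.not_gt]

/-- For every integer `n ≥ 2`, there exist `P, Q ∈ GL_{n-1}(ℤ)` such that
`P (1 - B) Q = diag(1, 1, …, 1, n)`; i.e. the Smith normal form of `1 - B` is
`diag(1, …, 1, n)`. -/
theorem smithNormalForm_one_sub_Bmat (n : ℕ) (hn : 2 ≤ n) :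
    ∃ P Q : Matrix (Fin (n - 1)) (Fin (n - 1)) ℤ, IsUnit P.det ∧ IsUnit Q.det ∧
      P * (1 - Bmat n) * Q =
        Matrix.diagonal (fun i : Fin (n - 1) => if (i : ℕ) = n - 2 then (n : ℤ) else 1) := by
  have hL := det_sub_subdiagonal (n - 1)
  have hV := det_one_add_lastColumn (n - 1)
  set L := 1 - Matrix.of fun i k : Fin (n - 1) => if (i : ℕ) = k + 1 then (1 : ℤ) else 0 with hLdef
  set V := 1 + Matrix.of fun i j : Fin (n - 1) =>
    if i < j ∧ (j : ℕ) + 1 = n - 1 then (i : ℤ) + 1 else 0 with hVdef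
  set D := Matrix.diagonal (fun i : Fin (n - 1) => if (i : ℕ) = n - 2 then (n : ℤ) else 1) with hD
  have hLu : IsUnit L.det := by simp [hL]
  have hVu : IsUnit V.det := by simp [hV]
  have key : 1 - Bmat n = L * (D * V) := by
    ext i j
    rw [hLdef, sub_subdiagonal_mul_apply]
    simp only [hD, hVdef, Matrix.diagonal_mul, Matrix.add_apply, Matrix.sub_apply,
      Matrix.one_apply, Matrix.of_apply, Bmat, Fin.ext_iff, Fin.lt_def]
    have := i.isLt
    have := j.isLt
    grind
  refine ⟨L⁻¹, V⁻¹, L.isUnit_nonsing_inv_det hLu, V.isUnit_nonsing_inv_det hVu, ?_⟩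
  rw [key, Matrix.nonsing_inv_mul_cancel_left _ _ hLu, Matrix.mul_nonsing_inv_cancel_right _ _ hVu]
end
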